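/- Let (E, {f_i}_{i=1}^m) ∈ 𝓔 with convex hull I. If f_1(I) ∩ f_2(I) = ∅ and f_{m−1}(I) ∩ f_m(I) = ∅, then for every integer s ≥ 0, dim_H U_{2^s}(E) ≥ dim_H U_1(E). -/

import Mathlib

open Set Filter MeasureTheory

/-- A self-similar iterated function system on `ℝ` given by `m` similitudes
`f i x = r i * x + t i` (for `1 ≤ i ≤ m`, `m ≥ 3`), together with its attractor `E`:
the unique nonempty compact set with `E = ⋃_{i=1}^m f_i(E)`. -/
structure ClassE where
  m : ℕ
  r : ℕ → ℝ
  t : ℕ → ℝ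
  E : Set ℝ
  hm : 3 ≤ m
  hr : ∀ i, 1 ≤ i → i ≤ m → 0 < r i ∧ r i < 1
  hEne : E.Nonempty
  hEcpt : IsCompact E
  hEinv : E = ⋃ i ∈ Finset.Icc 1 m, (fun x => r i * x + t i) '' E

namespace ClassE

/-- The `i`-th similitude. -/
def f (S : ClassE) (i : ℕ) (x : ℝ) : ℝ := S.r i * x + S.t i

/-- Left endpoint `a` of the convex hull of `E`. -/
noncomputable def a (S : ClassE) : ℝ := sInf S.E

/-- Right endpoint `b` of the convex hull of `E`. -/
noncomputable def b (S : ClassE) : ℝ := sSup S.E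

/-- The convex hull `I = [a, b]` of `E`. -/
noncomputable def I (S : ClassE) : Set ℝ := Set.Icc S.a S.b

/-- Condition (A): `a = f_1(a) < f_2(a) < ⋯ < f_m(a) < f_m(b) = b`. -/
def condA (S : ClassE) : Prop :=
  S.f 1 S.a = S.a ∧ (∀ i, 1 ≤ i → i < S.m → S.f i S.a < S.f (i + 1) S.a) ∧
    S.f S.m S.a < S.f S.m S.b ∧ S.f S.m S.b = S.b

/-- Condition (B): `f_i(I) ∩ f_{i+2}(I) = ∅` for all `1 ≤ i ≤ m - 2`. -/
def condB (S : ClassE) : Prop :=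
  ∀ i, 1 ≤ i → i + 2 ≤ S.m → S.f i '' S.I ∩ S.f (i + 2) '' S.I = ∅

/-- Condition (C): there are `i, j ∈ {1, …, m-1}` with `f_i(I) ∩ f_{i+1}(I) = ∅` and
`f_j(I) ∩ f_{j+1}(I) ≠ ∅`. -/
def condC (S : ClassE) : Prop :=
  (∃ i, 1 ≤ i ∧ i + 1 ≤ S.m ∧ S.f i '' S.I ∩ S.f (i + 1) '' S.I = ∅) ∧
    (∃ j, 1 ≤ j ∧ j + 1 ≤ S.m ∧ S.f j '' S.I ∩ S.f (j + 1) '' S.I ≠ ∅)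

/-- Condition (D): whenever `f_i(I) ∩ f_{i+1}(I) ≠ ∅` there are `u, v ≥ 1` with
`f_i(I) ∩ f_{i+1}(I) = f_i ∘ f_m^u (I) = f_{i+1} ∘ f_1^v (I)`. -/
def condD (S : ClassE) : Prop :=
  ∀ i, 1 ≤ i → i + 1 ≤ S.m → S.f i '' S.I ∩ S.f (i + 1) '' S.I ≠ ∅ →
    ∃ u v : ℕ, 1 ≤ u ∧ 1 ≤ v ∧
      S.f i '' S.I ∩ S.f (i + 1) '' S.I = (S.f i ∘ (S.f S.m)^[u]) '' S.I ∧
      S.f i '' S.I ∩ S.f (i + 1) '' S.I = (S.f (i + 1) ∘ (S.f 1)^[v]) '' S.I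

/-- Membership in the class `𝓔`: conditions (A)–(D). -/
def goodE (S : ClassE) : Prop := S.condA ∧ S.condB ∧ S.condC ∧ S.condD

/-- `prefixMap d n = f_{d 0} ∘ f_{d 1} ∘ ⋯ ∘ f_{d (n-1)}`. -/
def prefixMap (S : ClassE) (d : ℕ → ℕ) : ℕ → ℝ → ℝ
  | 0 => id
  | n + 1 => S.prefixMap d n ∘ S.f (d n)

/-- `d : ℕ → ℕ` (with digits in `{1, …, m}`) is a coding of `x` if
`x = lim_n f_{d 0} ∘ ⋯ ∘ f_{d (n-1)} (0)`. -/
def isCoding (S : ClassE) (d : ℕ → ℕ) (x : ℝ) : Prop :=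
  (∀ n, 1 ≤ d n ∧ d n ≤ S.m) ∧
    Tendsto (fun n => S.prefixMap d n 0) atTop (nhds x)

/-- The set of codings of `x`. -/
def codings (S : ClassE) (x : ℝ) : Set (ℕ → ℕ) := {d | S.isCoding d x}

/-- `U k E`: the set of points of `E` having exactly `k` distinct codings
(`k` a cardinal; e.g. `k = ℵ₀` for countably infinitely many codings,
`k = 𝔠 = 2^ℵ₀` for a continuum of codings). -/
def U (S : ClassE) (k : Cardinal) : Set ℝ :=
  {x ∈ S.E | Cardinal.mk (S.codings x) = k}

end ClassE

namespace ClassE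

/-- Prepend a digit. -/
def consd (i : ℕ) (d : ℕ → ℕ) : ℕ → ℕ
  | 0 => i
  | n + 1 => d n

theorem consd_inj (i : ℕ) : Function.Injective (consd i) := by
  intro d e h
  funext n
  exact congrFun h (n + 1)

theorem consd_shift (d : ℕ → ℕ) : consd (d 0) (fun n => d (n + 1)) = d := by
  funext n
  cases n <;> rfl

theorem prefix_consd (S : ClassE) (i : ℕ) (d : ℕ → ℕ) (n : ℕ) (x : ℝ) :
    S.prefixMap (consd i d) (n + 1) x = S.f i (S.prefixMap d n x) := by
  induction n generalizing x with
  | zero => rfl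
  | succ n ih =>
    have : S.prefixMap (consd i d) (n + 1 + 1) x
      = S.prefixMap (consd i d) (n + 1) (S.f (d n) x) := rfl
    rw [this, ih]
    rfl

theorem coding_consd (S : ClassE) (i : ℕ) (hi : 1 ≤ i ∧ i ≤ S.m) (d : ℕ → ℕ) (x : ℝ) :
    S.isCoding (consd i d) (S.f i x) ↔ S.isCoding d x := by
  have hr := (S.hr i hi.1 hi.2).1
  unfold isCoding
  have e : (∀ n, 1 ≤ consd i d n ∧ consd i d n ≤ S.m) ↔ (∀ n, 1 ≤ d n ∧ d n ≤ S.m) := by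
    constructor
    · intro h n
      exact h (n + 1)
    · intro h n
      cases n with
      | zero => exact hi
      | succ n => exact h n
  rw [e]
  apply and_congr_right
  intro _
  rw [← tendsto_add_atTop_iff_nat 1]
  simp only [prefix_consd]
  constructor
  · intro h
    have h3 := (h.sub_const (S.t i)).div_const (S.r i)
    simp only [f, add_sub_cancel_right] at h3
    have e1 : ∀ y, S.r i * y / S.r i = y := fun y => by field_simp
    simpa only [e1] using h3
  · intro h
    exact (h.const_mul (S.r i)).add_const (S.t i)

theorem f_mem_E (S : ClassE) {i : ℕ} (h1 : 1 ≤ i) (h2 : i ≤ S.m) {x : ℝ} (hx : x ∈ S.E) :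
    S.f i x ∈ S.E := by
  rw [S.hEinv]
  exact mem_biUnion (Finset.mem_Icc.2 ⟨h1, h2⟩ : i ∈ (Finset.Icc 1 S.m : Finset ℕ)) ⟨x, hx, rfl⟩

theorem iter_mem_E (S : ClassE) {i : ℕ} (h1 : 1 ≤ i) (h2 : i ≤ S.m) {x : ℝ} (hx : x ∈ S.E)
    (n : ℕ) : (S.f i)^[n] x ∈ S.E := by
  induction n with
  | zero => exact hx
  | succ n ih => rw [Function.iterate_succ_apply']; exact S.f_mem_E h1 h2 ih

theorem prefix_mem_E (S : ClassE) (d : ℕ → ℕ) (hd : ∀ n, 1 ≤ d n ∧ d n ≤ S.m) (n : ℕ) :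
    ∀ x ∈ S.E, S.prefixMap d n x ∈ S.E := by
  induction n with
  | zero => intro x hx; exact hx
  | succ n ih => intro x hx; exact ih _ (S.f_mem_E (hd n).1 (hd n).2 hx)

theorem exists_rho (S : ClassE) : ∃ ρ : ℝ, 0 ≤ ρ ∧ ρ < 1 ∧ ∀ i, 1 ≤ i → i ≤ S.m → S.r i ≤ ρ := by
  have hm := S.hm
  obtain ⟨j, hj, h⟩ := Finset.exists_max_image (Finset.Icc 1 S.m) S.r
    ⟨1, Finset.mem_Icc.2 ⟨le_rfl, by omega⟩⟩
  rw [Finset.mem_Icc] at hj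
  exact ⟨S.r j, (S.hr j hj.1 hj.2).1.le, (S.hr j hj.1 hj.2).2,
    fun i h1 h2 => h i (Finset.mem_Icc.2 ⟨h1, h2⟩)⟩

theorem coding_mem_E (S : ClassE) {d : ℕ → ℕ} {x : ℝ} (h : S.isCoding d x) : x ∈ S.E := by
  obtain ⟨hd, ht⟩ := h
  obtain ⟨ρ, h0, h1, hρ⟩ := S.exists_rho
  obtain ⟨z, hz⟩ := S.hEne
  have key : ∀ n x y, |S.prefixMap d n x - S.prefixMap d n y| ≤ ρ ^ n * |x - y| := by
    intro n
    induction n with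
    | zero => intro x y; simp [prefixMap]
    | succ n ih =>
      intro x y
      refine (ih (S.f (d n) x) (S.f (d n) y)).trans ?_
      have hp := S.hr _ (hd n).1 (hd n).2
      have : S.f (d n) x - S.f (d n) y = S.r (d n) * (x - y) := by unfold f; ring
      rw [this, abs_mul, abs_of_pos hp.1, pow_succ, mul_assoc]
      have := hρ _ (hd n).1 (hd n).2
      gcongr
  have hlim : Tendsto (fun n => S.prefixMap d n z - S.prefixMap d n 0) atTop (nhds 0) := by
    apply squeeze_zero_norm (a := fun n => ρ ^ n * |z - 0|)
    · intro n; exact key n z 0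
    · simpa using (tendsto_pow_atTop_nhds_zero_of_lt_one h0 h1).mul_const |z - 0|
  have h3 := hlim.add ht
  simp only [sub_add_cancel, zero_add] at h3
  exact S.hEcpt.isClosed.mem_of_tendsto h3 (Eventually.of_forall fun n => S.prefix_mem_E d hd n z hz)

theorem E_sub_I (S : ClassE) {x : ℝ} (hx : x ∈ S.E) : S.a ≤ x ∧ x ≤ S.b :=
  ⟨csInf_le S.hEcpt.bddBelow hx, le_csSup S.hEcpt.bddAbove hx⟩

theorem f_le (S : ClassE) {i : ℕ} (h1 : 1 ≤ i) (h2 : i ≤ S.m) {x y : ℝ} (h : x ≤ y) :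
    S.f i x ≤ S.f i y := by
  have := (S.hr i h1 h2).1
  unfold f
  nlinarith

theorem f_inj (S : ClassE) {i : ℕ} (h1 : 1 ≤ i) (h2 : i ≤ S.m) : Function.Injective (S.f i) := by
  have := (S.hr i h1 h2).1
  intro x y h
  unfold f at h
  exact mul_left_cancel₀ this.ne' (add_right_cancel h)

/-- decomposition of a coding -/
theorem coding_cases (S : ClassE) {e : ℕ → ℕ} {y : ℝ} (h : S.isCoding e y) :
    ∃ i d x, 1 ≤ i ∧ i ≤ S.m ∧ e = consd i d ∧ y = S.f i x ∧ S.isCoding d x ∧ x ∈ S.E := by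
  have hi := h.1 0
  have hr := (S.hr _ hi.1 hi.2).1
  have hy : y = S.f (e 0) ((y - S.t (e 0)) / S.r (e 0)) := by
    unfold f
    field_simp
    ring
  have h' := h
  rw [hy, ← consd_shift e] at h'
  have h3 := (S.coding_consd (e 0) hi _ _).1 h'
  exact ⟨e 0, _, _, hi.1, hi.2, (consd_shift e).symm, hy, h3, S.coding_mem_E h3⟩

theorem fa_mono (S : ClassE) (hA : S.condA) {i k : ℕ} (h1 : 1 ≤ i) (hik : i ≤ k) (hk : k ≤ S.m) :
    S.f i S.a ≤ S.f k S.a := by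
  induction k, hik using Nat.le_induction with
  | base => exact le_rfl
  | succ k hik ih => exact (ih (by omega)).trans (hA.2.1 k (by omega) (by omega)).le

theorem ab (S : ClassE) : S.a ≤ S.b := by
  obtain ⟨z, hz⟩ := S.hEne
  exact (S.E_sub_I hz).1.trans (S.E_sub_I hz).2

theorem sep (S : ClassE) (hA : S.condA) {i k : ℕ} (h1 : 1 ≤ i) (hik : i ≤ k) (hk : k ≤ S.m)
    (h : S.f i '' S.I ∩ S.f k '' S.I = ∅) : S.f i S.b < S.f k S.a := by
  by_contra hc
  push Not at hc
  have hr := (S.hr i h1 (by omega)).1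
  have h2 := S.fa_mono hA h1 hik hk
  have : S.f k S.a ∈ S.f i '' S.I ∩ S.f k '' S.I := by
    refine ⟨⟨(S.f k S.a - S.t i) / S.r i, ⟨?_, ?_⟩, ?_⟩, ⟨S.a, ⟨le_rfl, S.ab⟩, rfl⟩⟩
    · rw [le_div_iff₀ hr]; have : S.f i S.a = S.r i * S.a + S.t i := rfl
      linarith
    · rw [div_le_iff₀ hr]; have : S.f i S.b = S.r i * S.b + S.t i := rfl
      linarith
    · change S.r i * ((S.f k S.a - S.t i) / S.r i) + S.t i = _
      field_simp; ring
  rw [h] at this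
  exact this

theorem sep2 (S : ClassE) (hA : S.condA) (hB : S.condB) {i k : ℕ} (h1 : 1 ≤ i) (hik : i + 2 ≤ k)
    (hk : k ≤ S.m) : S.f i S.b < S.f k S.a :=
  (S.sep hA h1 (by omega) (by omega) (hB i h1 (by omega))).trans_le
    (S.fa_mono hA (by omega) hik hk)

theorem not_sep (S : ClassE) {i k : ℕ} (h1 : 1 ≤ i) (hi : i ≤ S.m) (h1k : 1 ≤ k) (hk : k ≤ S.m)
    (h : S.f i S.b < S.f k S.a) {x y : ℝ} (hx : x ∈ S.E) (hy : y ∈ S.E) : S.f i x ≠ S.f k y := by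
  have a1 := S.f_le h1 hi (S.E_sub_I hx).2
  have a2 := S.f_le h1k hk (S.E_sub_I hy).1
  intro h3
  linarith

theorem codings_of_isolated (S : ClassE) {k : ℕ} (h1k : 1 ≤ k) (hk : k ≤ S.m)
    (h : ∀ i, 1 ≤ i → i ≤ S.m → i ≠ k → ∀ x ∈ S.E, ∀ y ∈ S.E, S.f k x ≠ S.f i y)
    {x : ℝ} (hx : x ∈ S.E) : S.codings (S.f k x) = consd k '' S.codings x := by
  ext e
  constructor
  · intro he
    obtain ⟨i, d, y, hi1, hi2, rfl, hy, hd, hyE⟩ := S.coding_cases he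
    by_cases hik : i = k
    · subst hik
      rw [S.f_inj hi1 hi2 hy]
      exact ⟨d, hd, rfl⟩
    · exact absurd hy (h i hi1 hi2 hik x hx y hyE)
  · rintro ⟨d, hd, rfl⟩
    exact (S.coding_consd k ⟨h1k, hk⟩ d x).2 hd

theorem mk_codings_iter (S : ClassE) {k : ℕ} (h1k : 1 ≤ k) (hk : k ≤ S.m)
    (h : ∀ i, 1 ≤ i → i ≤ S.m → i ≠ k → ∀ x ∈ S.E, ∀ y ∈ S.E, S.f k x ≠ S.f i y)
    {x : ℝ} (hx : x ∈ S.E) (n : ℕ) :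
    Cardinal.mk (S.codings ((S.f k)^[n] x)) = Cardinal.mk (S.codings x) := by
  induction n with
  | zero => rfl
  | succ n ih =>
    rw [Function.iterate_succ_apply', S.codings_of_isolated h1k hk h (S.iter_mem_E h1k hk hx n),
      Cardinal.mk_image_eq (consd_inj k), ih]

theorem iter_affine (S : ClassE) {k : ℕ} (h1k : 1 ≤ k) (hk : k ≤ S.m) (n : ℕ) :
    ∃ p q : ℝ, 0 < p ∧ ∀ x, (S.f k)^[n] x = p * x + q := by
  induction n with
  | zero => exact ⟨1, 0, one_pos, fun x => by simp⟩
  | succ n ih =>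
    obtain ⟨p, q, hp, h⟩ := ih
    refine ⟨S.r k * p, S.r k * q + S.t k, mul_pos (S.hr k h1k hk).1 hp, fun x => ?_⟩
    rw [Function.iterate_succ_apply', h]
    unfold f
    ring

theorem comp_affine (S : ClassE) {j k : ℕ} (h1j : 1 ≤ j) (hj : j ≤ S.m)
    (h1k : 1 ≤ k) (hk : k ≤ S.m) (n : ℕ) :
    ∃ p q : ℝ, 0 < p ∧ ∀ x, S.f j ((S.f k)^[n] x) = p * x + q := by
  obtain ⟨p, q, hp, h⟩ := S.iter_affine h1k hk n
  refine ⟨S.r j * p, S.r j * q + S.t j, mul_pos (S.hr j h1j hj).1 hp, fun x => ?_⟩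
  rw [h]
  unfold f
  ring

theorem affine_eq {a b p q p' q' : ℝ} (hab : a < b) (hp : 0 < p) (hp' : 0 < p')
    (h : (fun x => p * x + q) '' Icc a b = (fun x => p' * x + q') '' Icc a b) :
    p = p' ∧ q = q' := by
  have im : ∀ p q : ℝ, 0 < p → (fun x => p * x + q) '' Icc a b = Icc (p * a + q) (p * b + q) := by
    intro p q hp
    exact image_affine_Icc' hp q a b
  rw [im p q hp, im p' q' hp'] at h
  have hle : p * a + q ≤ p * b + q := by nlinarith
  obtain ⟨h1, h2⟩ := (Icc_eq_Icc_iff hle).1 h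
  have : (p - p') * (b - a) = 0 := by linarith
  have hpp : p = p' := by
    rcases mul_eq_zero.1 this with h | h <;> linarith
  subst hpp
  exact ⟨rfl, by linarith⟩

theorem step (S : ClassE) (hS : S.goodE)
    (h1 : S.f 1 '' S.I ∩ S.f 2 '' S.I = ∅)
    (h2 : S.f (S.m - 1) '' S.I ∩ S.f S.m '' S.I = ∅) :
    ∃ p q : ℝ, 0 < p ∧ ∀ (k : ℕ), ∀ x ∈ S.U k, p * x + q ∈ S.U (2 * k : ℕ) := by
  obtain ⟨hA, hB, ⟨-, j, hj1, hjm, hj⟩, hD⟩ := hS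
  obtain ⟨u, v, -, -, hu, hv⟩ := hD j hj1 hjm hj
  have hm := S.hm
  have hab : S.a < S.b := by
    have h3 := hA.2.2.1
    have := (S.hr S.m (by omega) le_rfl).1
    unfold f at h3
    nlinarith
  obtain ⟨p, q, hp, hpq⟩ := S.comp_affine hj1 (by omega) (show 1 ≤ S.m by omega) le_rfl u
  obtain ⟨p', q', hp', hpq'⟩ := S.comp_affine (show 1 ≤ j + 1 by omega) hjm le_rfl
    (show 1 ≤ S.m by omega) v
  have heq : p = p' ∧ q = q' := by
    refine affine_eq hab hp hp' ?_
    have e1 : (S.f j ∘ (S.f S.m)^[u]) = fun x => p * x + q := funext hpq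
    have e2 : (S.f (j + 1) ∘ (S.f 1)^[v]) = fun x => p' * x + q' := funext hpq'
    rw [← e1, ← e2]
    exact hu.symm.trans hv
  obtain ⟨rfl, rfl⟩ := heq
  have iso1 : ∀ i, 1 ≤ i → i ≤ S.m → i ≠ 1 → ∀ x ∈ S.E, ∀ y ∈ S.E, S.f 1 x ≠ S.f i y := by
    intro i hi1 him hi x hx y hy
    refine S.not_sep le_rfl (by omega) hi1 him ?_ hx hy
    exact (S.sep hA le_rfl (by omega) (by omega) h1).trans_le (S.fa_mono hA (by omega) (by omega) him)
  have isom : ∀ i, 1 ≤ i → i ≤ S.m → i ≠ S.m → ∀ x ∈ S.E, ∀ y ∈ S.E, S.f S.m x ≠ S.f i y := by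
    intro i hi1 him hi x hx y hy
    refine (S.not_sep hi1 him (by omega) le_rfl ?_ hy hx).symm
    by_cases h : i = S.m - 1
    · rw [h]; exact S.sep hA (by omega) (by omega) le_rfl h2
    · exact S.sep2 hA hB hi1 (by omega) le_rfl
  refine ⟨p, q, hp, ?_⟩
  rintro k x ⟨hxE, hxk⟩
  have mE := S.iter_mem_E (show 1 ≤ S.m by omega) le_rfl hxE u
  have oE := S.iter_mem_E le_rfl (show 1 ≤ S.m by omega) hxE v
  refine ⟨by rw [← hpq]; exact S.f_mem_E hj1 (by omega) mE, ?_⟩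
  have hcod : S.codings (p * x + q) = consd j '' S.codings ((S.f S.m)^[u] x) ∪
      consd (j + 1) '' S.codings ((S.f 1)^[v] x) := by
    ext e
    constructor
    · intro he
      obtain ⟨i, d, y, hi1, hi2, rfl, hy, hd, hyE⟩ := S.coding_cases he
      rcases lt_trichotomy i j with h | h | h
      · exact absurd (hy.symm.trans (hpq' x).symm)
          (S.not_sep hi1 hi2 (by omega) hjm (S.sep2 hA hB hi1 (by omega) hjm) hyE oE)
      · subst h
        left
        rw [S.f_inj hi1 hi2 ((hpq x).trans hy)]
        exact ⟨d, hd, rfl⟩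
      · by_cases h' : i = j + 1
        · subst h'
          right
          rw [S.f_inj hi1 hi2 ((hpq' x).trans hy)]
          exact ⟨d, hd, rfl⟩
        · exact absurd ((hpq x).trans hy)
            (S.not_sep hj1 (by omega) hi1 hi2 (S.sep2 hA hB hj1 (by omega) hi2) mE hyE)
    · rintro (⟨d, hd, rfl⟩ | ⟨d, hd, rfl⟩)
      · rw [← hpq x]
        exact (S.coding_consd j ⟨hj1, by omega⟩ d _).2 hd
      · rw [← hpq' x]
        exact (S.coding_consd (j + 1) ⟨by omega, hjm⟩ d _).2 hd
  have hdisj : Disjoint (consd j '' S.codings ((S.f S.m)^[u] x))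
      (consd (j + 1) '' S.codings ((S.f 1)^[v] x)) := by
    rw [Set.disjoint_left]
    rintro _ ⟨d, -, rfl⟩ ⟨e, -, h⟩
    have h0 : j + 1 = j := congrFun h 0
    omega
  rw [hcod, Cardinal.mk_union_of_disjoint hdisj, Cardinal.mk_image_eq (consd_inj _),
    Cardinal.mk_image_eq (consd_inj _), S.mk_codings_iter (by omega) le_rfl isom hxE,
    S.mk_codings_iter le_rfl (by omega) iso1 hxE, hxk]
  push_cast
  rw [two_mul]

theorem dimH_step {p q : ℝ} (hp : 0 < p) {A B : Set ℝ} (h : ∀ x ∈ A, p * x + q ∈ B) :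
    dimH A ≤ dimH B := by
  have hanti : AntilipschitzWith (Real.toNNReal p⁻¹) (fun x : ℝ => p * x + q) := by
    apply AntilipschitzWith.of_le_mul_dist
    intro x y
    rw [Real.coe_toNNReal _ (inv_pos.2 hp).le, Real.dist_eq, Real.dist_eq]
    have : p * x + q - (p * y + q) = p * (x - y) := by ring
    rw [this, abs_mul, abs_of_pos hp]
    field_simp
    exact le_rfl
  refine (hanti.le_dimH_image A).trans (dimH_mono ?_)
  rintro _ ⟨x, hx, rfl⟩
  exact h x hx

end ClassE

open ClassE

theorem stmt15 (S : ClassE) (hS : S.goodE)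
    (h1 : S.f 1 '' S.I ∩ S.f 2 '' S.I = ∅)
    (h2 : S.f (S.m - 1) '' S.I ∩ S.f S.m '' S.I = ∅) :
    ∀ s : ℕ, dimH (S.U 1) ≤ dimH (S.U (2 ^ s : ℕ)) := by
  obtain ⟨p, q, hp, h⟩ := S.step hS h1 h2
  intro s
  induction s with
  | zero => simp
  | succ s ih =>
    refine ih.trans ?_
    rw [pow_succ']
    exact dimH_step hp (h (2 ^ s))
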